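/- arXiv:math/0312074 — 2 statements merged into one kernel-verified Lean document; each statement's English description precedes it below -/
import Mathlib

section
/- Let X be a topological space such that every continuous map from the 2-sphere S² to X is nullhomotopic. Let S¹ denote the unit circle in ℂ and D² the closed unit disc in ℂ. Suppose f : S¹ × S¹ → X is continuous and that for some s₀ ∈ S¹ the loop t ↦ f(s₀, t) is nullhomotopic in X. Then f extends to the solid torus: there exists a continuous map F : S¹ × D² → X such that F(s, t) = f(s, t) for all s ∈ S¹ and all t ∈ S¹ ⊆ D². -/
open Metric

open Classical in
/-- Radial projection onto the unit sphere, sending the origin to the base point `b`. -/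
noncomputable def radialProj {E : Type*} [NormedAddCommGroup E] [NormedSpace ℝ E]
    (b : sphere (0 : E) 1) (v : E) : sphere (0 : E) 1 :=
  if h : v = 0 then b else ⟨‖v‖⁻¹ • v, by simp [norm_smul, h]⟩

section RadialProj

variable {E : Type*} [NormedAddCommGroup E] [NormedSpace ℝ E]

lemma coe_radialProj (b : sphere (0 : E) 1) {v : E} (h : v ≠ 0) :
    (radialProj b v : E) = ‖v‖⁻¹ • v := by
  simp [radialProj, h]

lemma radialProj_coe (b v : sphere (0 : E) 1) : radialProj b (v : E) = v := by
  ext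
  rw [coe_radialProj b (ne_zero_of_mem_unit_sphere v)]
  simp

lemma radialProj_smul (b : sphere (0 : E) 1) {r : ℝ} (hr : 0 < r) {v : E} (h : v ≠ 0) :
    radialProj b (r • v) = radialProj b v := by
  ext
  rw [coe_radialProj b h, coe_radialProj b (smul_ne_zero hr.ne' h), norm_smul, smul_smul,
    Real.norm_of_nonneg hr.le]
  congr 1
  field_simp

lemma continuousOn_radialProj (b : sphere (0 : E) 1) :
    ContinuousOn (radialProj b) {0}ᶜ := by
  rw [Topology.IsInducing.subtypeVal.continuousOn_iff]
  refine ContinuousOn.congr (f := fun v : E => ‖v‖⁻¹ • v) ?_ fun v hv => coe_radialProj b hv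
  exact (continuousOn_id.norm.inv₀ fun v hv => norm_ne_zero_iff.2 hv).smul continuousOn_id

/-- A nullhomotopic map on the unit sphere extends continuously to the whole space. -/
lemma ContinuousMap.Nullhomotopic.exists_extension {X : Type*} [TopologicalSpace X]
    {g : C(sphere (0 : E) 1, X)} (hg : g.Nullhomotopic) (b : sphere (0 : E) 1) :
    ∃ G : C(E, X), ∀ v : sphere (0 : E) 1, G v = g v := by
  obtain ⟨x, ⟨H⟩⟩ := hg
  let τ : E → unitInterval := fun v => Set.projIcc 0 1 zero_le_one (2 * (1 - ‖v‖))
  have hτ : Continuous τ := continuous_projIcc.comp (by fun_prop)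
  have hG : Continuous fun v : E => H (τ v, radialProj b v) := by
    rw [continuous_iff_continuousAt]
    intro v
    by_cases hv : v = 0
    · have h_near : ∀ᶠ w in nhds v, H (τ w, radialProj b w) = x := by
        filter_upwards [ball_mem_nhds v (show (0 : ℝ) < 1 / 2 by norm_num)] with w hw
        rw [hv, mem_ball_zero_iff] at hw
        have : τ w = 1 := Set.projIcc_of_right_le _ (by linarith)
        rw [this, H.apply_one]
        rfl
      exact continuousAt_const.congr (h_near.mono fun _ h => h.symm)
    · have hp : ContinuousAt (radialProj b) v :=
        (continuousOn_radialProj b).continuousAt (isOpen_compl_singleton.mem_nhds hv)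
      exact H.continuous.continuousAt.comp (hτ.continuousAt.prodMk hp)
  refine ⟨⟨_, hG⟩, fun v => ?_⟩
  have : τ v = 0 := Set.projIcc_of_le_left _ (by simp)
  simp [this, radialProj_coe]

/-- Nullhomotopy of all maps out of the unit sphere depends only on the isomorphism class of the
underlying topological vector space, not on the norm. -/
lemma nullhomotopic_of_continuousLinearEquiv {F : Type*} [NormedAddCommGroup F]
    [NormedSpace ℝ F] (e : E ≃L[ℝ] F) (b : sphere (0 : E) 1) {X : Type*} [TopologicalSpace X]
    (hF : ∀ g : C(sphere (0 : F) 1, X), g.Nullhomotopic) (g : C(sphere (0 : E) 1, X)) :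
    g.Nullhomotopic := by
  have heb : e b ≠ 0 := e.map_ne_zero_iff.2 (ne_zero_of_mem_unit_sphere b)
  let b' : sphere (0 : F) 1 := ⟨‖e b‖⁻¹ • e b, by simp [norm_smul, heb]⟩
  have hne : ∀ v : sphere (0 : E) 1, e v ≠ 0 := fun v =>
    e.map_ne_zero_iff.2 (ne_zero_of_mem_unit_sphere v)
  have hne' : ∀ w : sphere (0 : F) 1, e.symm w ≠ 0 := fun w =>
    e.symm.map_ne_zero_iff.2 (ne_zero_of_mem_unit_sphere w)
  let φ : C(sphere (0 : E) 1, sphere (0 : F) 1) :=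
    ⟨fun v => radialProj b' (e v), (continuousOn_radialProj b').comp_continuous
      (e.continuous.comp continuous_subtype_val) hne⟩
  let ψ : C(sphere (0 : F) 1, sphere (0 : E) 1) :=
    ⟨fun w => radialProj b (e.symm w), (continuousOn_radialProj b).comp_continuous
      (e.symm.continuous.comp continuous_subtype_val) hne'⟩
  have h : (g.comp ψ).comp φ = g := by
    ext v
    change g (radialProj b (e.symm (radialProj b' (e v)))) = g v
    rw [coe_radialProj b' (hne v), map_smul, e.symm_apply_apply,
      radialProj_smul b (inv_pos.2 (norm_pos_iff.2 (hne v))) (ne_zero_of_mem_unit_sphere v),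
      radialProj_coe]
  exact h ▸ (hF (g.comp ψ)).comp_left φ

end RadialProj

/-- The cylinder `[-1, 1] × D²` is the unit ball of the sup norm on `ℝ × ℂ`; a map on its lateral
surface and one on its caps that agree along the rims glue to a map on its boundary sphere. -/
lemma exists_map_sphere_of_lateral_of_caps {X : Type*} [TopologicalSpace X]
    (l : C(ℝ × sphere (0 : ℂ) 1, X)) (h : C(ℂ, X))
    (hl : ∀ (r : ℝ) (t : sphere (0 : ℂ) 1), |r| = 1 → l (r, t) = h t) :
    ∃ g : C(sphere (0 : ℝ × ℂ) 1, X),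
      (∀ p : sphere (0 : ℝ × ℂ) 1, |p.1.1| = 1 → g p = h p.1.2) ∧
      ∀ (p : sphere (0 : ℝ × ℂ) 1) (t : sphere (0 : ℂ) 1), p.1.2 = t → g p = l (p.1.1, t) := by
  have h_max : ∀ p : sphere (0 : ℝ × ℂ) 1, max |p.1.1| ‖p.1.2‖ = 1 := fun p => by
    rw [← Real.norm_eq_abs, ← Prod.norm_def]
    exact mem_sphere_zero_iff_norm.1 p.2
  have h_rim : ∀ (r : ℝ) (z : ℂ), |r| = 1 → ‖z‖ = 1 → h z = l (r, radialProj 1 z) := by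
    intro r z hr hz
    have hz' := radialProj_coe 1 (⟨z, mem_sphere_zero_iff_norm.2 hz⟩ : sphere (0 : ℂ) 1)
    rw [hz', hl r _ hr]
  refine ⟨⟨fun p => if ‖p.1.2‖ ≤ |p.1.1| then h p.1.2 else l (p.1.1, radialProj 1 p.1.2), ?_⟩,
    fun p hp => ?_, fun p t hpt => ?_⟩
  · refine continuous_if_le (by fun_prop) (by fun_prop) (by fun_prop) ?_ ?_
    · refine l.continuous.comp_continuousOn (ContinuousOn.prodMk (by fun_prop) ?_)
      refine (continuousOn_radialProj 1).comp (by fun_prop) fun p hp h0 => ?_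
      have := h_max p
      rw [max_eq_right hp, h0] at this
      simp at this
    · intro p hp
      have := h_max p
      rw [hp, max_self] at this
      exact h_rim _ _ this (hp.trans this)
  · have : ‖p.1.2‖ ≤ |p.1.1| := ((le_max_right _ _).trans_eq (h_max p)).trans_eq hp.symm
    simp [this]
  · have ht : ‖p.1.2‖ = 1 := by rw [hpt]; exact mem_sphere_zero_iff_norm.1 t.2
    have hproj : radialProj 1 p.1.2 = t := by rw [hpt, radialProj_coe]
    change (if ‖p.1.2‖ ≤ |p.1.1| then _ else _) = _
    split_ifs with hle
    · rw [← hproj]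
      refine h_rim _ _ (le_antisymm ?_ (ht.symm.trans_le hle)) ht
      exact (le_max_left _ _).trans_eq (h_max p)
    · rw [hproj]


/-- If every continuous map `S² → X` is nullhomotopic and `f : S¹ × S¹ → X` is a
continuous map whose restriction to some meridian `{s₀} × S¹` is nullhomotopic,
then `f` extends to a continuous map on the solid torus `S¹ × D²`. -/
theorem extends_to_solid_torus_of_meridian_nullhomotopic
    (X : Type*) [TopologicalSpace X]
    (hS2 : ∀ g : C(Metric.sphere (0 : EuclideanSpace ℝ (Fin 3)) 1, X), g.Nullhomotopic)
    (f : C(Metric.sphere (0 : ℂ) 1 × Metric.sphere (0 : ℂ) 1, X))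
    (s₀ : Metric.sphere (0 : ℂ) 1)
    (hmer : (f.comp ⟨fun t => (s₀, t), by continuity⟩ :
        C(Metric.sphere (0 : ℂ) 1, X)).Nullhomotopic) :
    ∃ F : C(Metric.sphere (0 : ℂ) 1 × Metric.closedBall (0 : ℂ) 1, X),
      ∀ (s t : Metric.sphere (0 : ℂ) 1),
        F (s, ⟨(t : ℂ), Metric.sphere_subset_closedBall t.2⟩) = f (s, t) := by
  obtain ⟨h, hh⟩ := hmer.exists_extension 1
  let c : C(ℝ, sphere (0 : ℂ) 1) :=
    ⟨fun r => (Circle.exp (Real.pi * (r + 1)) : Circle) * (show Circle from s₀), by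
      exact (Circle.exp.continuous.comp (by fun_prop)).mul continuous_const⟩
  have hc : ∀ r : ℝ, |r| = 1 → c r = s₀ := by
    intro r hr
    have h_exp : Circle.exp (Real.pi * (r + 1)) = 1 := by
      rcases eq_or_eq_neg_of_abs_eq hr with rfl | rfl
      · rw [show Real.pi * (1 + 1) = 2 * Real.pi by ring, Circle.exp_two_pi]
      · simp
    change Circle.exp (Real.pi * (r + 1)) * (show Circle from s₀) = s₀
    rw [h_exp]
    exact one_mul (show Circle from s₀)
  obtain ⟨g, hg_cap, hg_lat⟩ := exists_map_sphere_of_lateral_of_caps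
    (f.comp (c.prodMap (.id _))) h (by
      intro r t hr
      rw [hh t]
      change f (c r, t) = f (s₀, t)
      rw [hc r hr])
  let e : (ℝ × ℂ) ≃L[ℝ] EuclideanSpace ℝ (Fin 3) :=
    ContinuousLinearEquiv.ofFinrankEq (by simp)
  obtain ⟨G, hG⟩ := (nullhomotopic_of_continuousLinearEquiv e
    ⟨((1 : ℝ), (0 : ℂ)), by simp [Prod.norm_def]⟩ hS2 g).exists_extension
      ⟨((1 : ℝ), (0 : ℂ)), by simp [Prod.norm_def]⟩
  have hG_cap : ∀ (r : ℝ) (z : closedBall (0 : ℂ) 1), |r| = 1 → G (r, z) = h z := by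
    intro r z hr
    have hz : ‖(z : ℂ)‖ ≤ 1 := mem_closedBall_zero_iff.1 z.2
    have hp : (r, (z : ℂ)) ∈ sphere (0 : ℝ × ℂ) 1 := by simp [Prod.norm_def, hr, hz]
    exact (hG ⟨_, hp⟩).trans (hg_cap ⟨_, hp⟩ hr)
  have hG_lat : ∀ (r : ℝ) (t : sphere (0 : ℂ) 1), |r| ≤ 1 → G (r, t) = f (c r, t) := by
    intro r t hr
    have hp : (r, (t : ℂ)) ∈ sphere (0 : ℝ × ℂ) 1 := by simp [Prod.norm_def, hr]
    exact (hG ⟨_, hp⟩).trans (hg_lat ⟨_, hp⟩ t rfl)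
  let slice : C(ℝ, C(closedBall (0 : ℂ) 1, X)) :=
    (G.comp ⟨fun q : ℝ × closedBall (0 : ℂ) 1 => (q.1 / Real.pi - 1, (q.2 : ℂ)),
      by fun_prop⟩).curry
  have : Fact (0 < 2 * Real.pi) := ⟨Real.two_pi_pos⟩
  have h_ends : slice 0 = slice (0 + 2 * Real.pi) := by
    ext z
    change G (0 / Real.pi - 1, z) = G ((0 + 2 * Real.pi) / Real.pi - 1, z)
    have h2 : (0 + 2 * Real.pi) / Real.pi - 1 = 1 := by
      rw [zero_add, mul_div_cancel_right₀ _ Real.pi_ne_zero]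
      norm_num
    rw [h2, hG_cap _ _ (by simp), hG_cap _ _ (by simp)]
  let L : C(AddCircle (2 * Real.pi), C(closedBall (0 : ℂ) 1, X)) :=
    ⟨_, AddCircle.liftIco_continuous h_ends slice.continuous.continuousOn⟩
  let angle : C(sphere (0 : ℂ) 1, AddCircle (2 * Real.pi)) :=
    ⟨fun s => AddCircle.homeomorphCircle'.symm ((show Circle from s) / (show Circle from s₀)), by
      refine AddCircle.homeomorphCircle'.symm.continuous.comp ?_
      exact (continuous_id (X := Circle)).div' continuous_const⟩
  refine ⟨(L.comp angle).uncurry, fun s t => ?_⟩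
  obtain ⟨θ, hθ, h_angle⟩ := AddCircle.eq_coe_Ico (angle s)
  have h_exp : Circle.exp θ = (show Circle from s) / (show Circle from s₀) := by
    rw [← AddCircle.homeomorphCircle'_apply_mk, h_angle]
    exact AddCircle.homeomorphCircle'.apply_symm_apply _
  have h_c : c (θ / Real.pi - 1) = s := by
    change Circle.exp (Real.pi * (θ / Real.pi - 1 + 1)) * (show Circle from s₀) = s
    rw [sub_add_cancel, mul_div_cancel₀ _ Real.pi_ne_zero, h_exp]
    exact div_mul_cancel (show Circle from s) (show Circle from s₀)
  have h_abs : |θ / Real.pi - 1| ≤ 1 := by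
    have h0 : 0 ≤ θ / Real.pi := div_nonneg hθ.1 Real.pi_pos.le
    have h2 : θ / Real.pi ≤ 2 := (div_le_iff₀ Real.pi_pos).2 hθ.2.le
    rw [abs_le]
    constructor <;> linarith
  change AddCircle.liftIco (2 * Real.pi) 0 slice (angle s) _ = _
  rw [← h_angle, AddCircle.liftIco_zero_coe_apply hθ]
  exact (hG_lat _ t h_abs).trans (by rw [h_c])
end

section
/- Let X be a topological space such that every continuous map from the 2-sphere S² to X is nullhomotopic, and such that for every point x ∈ X every nontrivial abelian subgroup of the fundamental group π₁(X, x) is infinite cyclic. Let S¹ denote the unit circle in ℂ and D² the closed unit disc in ℂ. Then for every continuous map f : S¹ × S¹ → X there exist integers a, b, c, d with ad − bc ≠ 0 such that the map f ∘ p, where p : S¹ × S¹ → S¹ × S¹ is defined by p(s, t) = (sᵃ tᵇ, sᶜ tᵈ), extends to a continuous map on the solid torus: there exists a continuous F : S¹ × D² → X with F(s, t) = f(p(s, t)) for all s ∈ S¹ and all t ∈ S¹ ⊆ D². -/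
open Metric Topology unitInterval

/-- Every point of the circle is `exp (2πu)` for some `u` in the unit interval. -/
theorem Circle.exists_unitInterval_eq_exp (z : Circle) :
    ∃ u : I, z = Circle.exp (2 * Real.pi * u) := by
  refine ⟨⟨Int.fract (Complex.arg z / (2 * Real.pi)), Int.fract_nonneg _,
    (Int.fract_lt_one _).le⟩, ?_⟩
  change z = Circle.exp (2 * Real.pi * Int.fract (Complex.arg z / (2 * Real.pi)))
  rw [← Int.self_sub_floor, mul_sub, mul_div_cancel₀ _ Real.two_pi_pos.ne', Circle.exp_sub,
    Circle.exp_arg, Circle.exp_two_pi_mul_int, div_one]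

/-- A continuous map on `I × K` which agrees on the two ends descends to `Circle × K`. -/
theorem exists_continuousMap_circle_prod {K X : Type*} [TopologicalSpace K] [CompactSpace K]
    [T2Space K] [TopologicalSpace X] (f : C(I × K, X)) (hf : ∀ k, f (0, k) = f (1, k)) :
    ∃ F : C(Circle × K, X), ∀ (u : I) (k : K), F (Circle.exp (2 * Real.pi * u), k) = f (u, k) := by
  let q : C(I × K, Circle × K) :=
    ⟨fun w => (Circle.exp (2 * Real.pi * w.1), w.2), by fun_prop⟩
  have hsurj : Function.Surjective q := by
    rintro ⟨z, k⟩
    obtain ⟨u, rfl⟩ := z.exists_unitInterval_eq_exp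
    exact ⟨(u, k), rfl⟩
  have hq : IsQuotientMap q := q.continuous.isClosedMap.isQuotientMap q.continuous hsurj
  have hfac : Function.FactorsThrough f q := by
    rintro ⟨u, k⟩ ⟨v, l⟩ h
    obtain ⟨h₁, rfl⟩ := Prod.mk.inj h
    obtain ⟨m, hm⟩ := Circle.exp_eq_exp.1 h₁
    have huv : (u : ℝ) = v + m := by
      have := Real.two_pi_pos
      nlinarith
    have h1 : m ≤ 1 := by
      have : (m : ℝ) ≤ 1 := by linarith [u.2.2, v.2.1]
      exact_mod_cast this
    have h2 : -1 ≤ m := by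
      have : (-1 : ℝ) ≤ m := by linarith [u.2.1, v.2.2]
      exact_mod_cast this
    obtain rfl | rfl | rfl : m = -1 ∨ m = 0 ∨ m = 1 := by omega
    · have hu : u = 0 := Subtype.ext (by push_cast at huv ⊢; linarith [u.2.1, v.2.2])
      have hv : v = 1 := Subtype.ext (by push_cast at huv ⊢; linarith [u.2.1, v.2.2])
      rw [hu, hv, hf]
    · rw [show u = v from Subtype.ext (by simpa using huv)]
    · have hu : u = 1 := Subtype.ext (by push_cast at huv ⊢; linarith [u.2.2, v.2.1])
      have hv : v = 0 := Subtype.ext (by push_cast at huv ⊢; linarith [u.2.2, v.2.1])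
      rw [hu, hv, hf]
  refine ⟨hq.lift f hfac, fun u k => ?_⟩
  exact DFunLike.congr_fun (hq.lift_comp f hfac) (u, k)

/-- A map on the circle is nullhomotopic if the loop it defines is trivial. -/
theorem nullhomotopic_of_loop_homotopic_refl {X : Type*} [TopologicalSpace X] (p : C(Circle, X))
    {x : X} (γ : Path x x) (hγ : ∀ u : I, γ u = p (Circle.exp (2 * Real.pi * u)))
    (h : γ.Homotopic (Path.refl x)) : p.Nullhomotopic := by
  obtain ⟨H⟩ := h
  obtain ⟨F, hF⟩ := exists_continuousMap_circle_prod
    (H.toContinuousMap.comp ContinuousMap.prodSwap) (fun t => by simp)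
  refine ⟨x, ⟨⟨F.comp ContinuousMap.prodSwap, fun z => ?_, fun z => ?_⟩⟩⟩
  · obtain ⟨u, rfl⟩ := z.exists_unitInterval_eq_exp
    simpa [hγ] using hF u 0
  · obtain ⟨u, rfl⟩ := z.exists_unitInterval_eq_exp
    simpa using hF u 1

/-- A nullhomotopic map on the unit sphere extends to the closed unit ball. -/
theorem ContinuousMap.Nullhomotopic.exists_extension_closedBall {E X : Type*}
    [NormedAddCommGroup E] [NormedSpace ℝ E] [ProperSpace E] [Nontrivial E] [TopologicalSpace X]
    {h : C(sphere (0 : E) 1, X)} (hh : h.Nullhomotopic) :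
    ∃ F : C(closedBall (0 : E) 1, X), ∀ v : sphere (0 : E) 1,
      F ⟨v, sphere_subset_closedBall v.2⟩ = h v := by
  obtain ⟨y, ⟨H⟩⟩ := hh
  let q : C(I × sphere (0 : E) 1, closedBall (0 : E) 1) :=
    ⟨fun w => ⟨(w.1 : ℝ) • (w.2 : E), by
      simpa [norm_smul, abs_of_nonneg w.1.2.1] using w.1.2.2⟩, by fun_prop⟩
  have hsurj : Function.Surjective q := by
    rintro ⟨w, hw⟩
    rw [mem_closedBall_zero_iff] at hw
    by_cases h0 : w = 0
    · obtain ⟨v, hv⟩ := NormedSpace.sphere_nonempty (x := (0 : E)).2 zero_le_one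
      exact ⟨(0, ⟨v, hv⟩), Subtype.ext (by simp [q, h0])⟩
    · refine ⟨(⟨‖w‖, norm_nonneg _, hw⟩, ⟨‖w‖⁻¹ • w, ?_⟩), Subtype.ext ?_⟩
      · simp [norm_smul, h0]
      · simp [q, smul_smul, h0]
  have hq : IsQuotientMap q := q.continuous.isClosedMap.isQuotientMap q.continuous hsurj
  let G : C(I × sphere (0 : E) 1, X) := ⟨fun w => H (σ w.1, w.2), by fun_prop⟩
  have hfac : Function.FactorsThrough G q := by
    rintro ⟨t, v⟩ ⟨t', v'⟩ hw
    have hw : (t : ℝ) • (v : E) = (t' : ℝ) • (v' : E) := congrArg Subtype.val hw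
    have ht : t = t' := Subtype.ext (by
      simpa [norm_smul, abs_of_nonneg t.2.1, abs_of_nonneg t'.2.1] using congrArg norm hw)
    subst ht
    by_cases h0 : t = 0
    · simp [G, h0]
    · have h0' : (t : ℝ) ≠ 0 := fun h => h0 (Subtype.ext h)
      rw [show v = v' from Subtype.ext (smul_right_injective E h0' hw)]
  refine ⟨hq.lift G hfac, fun v => ?_⟩
  have hv : q (1, v) = ⟨v, sphere_subset_closedBall v.2⟩ := Subtype.ext (one_smul ℝ (v : E))
  have hG : G (1, v) = h v := by simp [G]
  rw [← hv, ← hG]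
  exact DFunLike.congr_fun (hq.lift_comp G hfac) (1, v)

/-- If all maps from the unit sphere of `E` to `X` are nullhomotopic, the same holds for the unit
sphere of any linearly homeomorphic space. -/
theorem nullhomotopic_sphere_of_equiv {E E' X : Type*} [NormedAddCommGroup E] [NormedSpace ℝ E]
    [NormedAddCommGroup E'] [NormedSpace ℝ E'] [TopologicalSpace X] (e : E ≃L[ℝ] E')
    (hE : ∀ g : C(sphere (0 : E) 1, X), g.Nullhomotopic) (h : C(sphere (0 : E') 1, X)) :
    h.Nullhomotopic := by
  have hne : ∀ v : sphere (0 : E) 1, e v ≠ 0 := fun v => by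
    simpa using ne_zero_of_mem_unit_sphere v
  have hne' : ∀ v : sphere (0 : E') 1, e.symm v ≠ 0 := fun v => by
    simpa using ne_zero_of_mem_unit_sphere v
  let ρ : C(sphere (0 : E) 1, sphere (0 : E') 1) :=
    ⟨fun v => ⟨‖e v‖⁻¹ • e v, by simp [norm_smul, hne v]⟩,
      by fun_prop (disch := exact fun v => norm_ne_zero_iff.2 (hne v))⟩
  let ρ' : C(sphere (0 : E') 1, sphere (0 : E) 1) :=
    ⟨fun v => ⟨‖e.symm v‖⁻¹ • e.symm v, by simp [norm_smul, hne' v]⟩,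
      by fun_prop (disch := exact fun v => norm_ne_zero_iff.2 (hne' v))⟩
  have hρ : h = (h.comp ρ).comp ρ' := by
    ext v
    have : ρ (ρ' v) = v := Subtype.ext (by
      have hv := norm_ne_zero_iff.2 (hne' v)
      simp [ρ, ρ', norm_smul, smul_smul, hv])
    simp [this]
  rw [hρ]
  exact (hE _).comp_left ρ'

/-- A complex number of norm one as a point of the circle. -/
def Circle.ofNormEqOne (z : ℂ) (hz : ‖z‖ = 1) : Circle :=
  ⟨z, mem_sphere_zero_iff_norm.2 hz⟩

theorem Circle.coe_ofNormEqOne (z : ℂ) (hz : ‖z‖ = 1) : (Circle.ofNormEqOne z hz : ℂ) = z :=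
  rfl

/-- Radial projection of the complex plane to the unit circle, with value `1` at the origin. -/
noncomputable def circleProj (z : ℂ) : Circle :=
  if h : z = 0 then 1 else Circle.ofNormEqOne (z / ‖z‖) (by simp [h])

theorem circleProj_of_norm_eq_one {z : ℂ} (hz : ‖z‖ = 1) :
    circleProj z = Circle.ofNormEqOne z hz := by
  have h0 : z ≠ 0 := norm_ne_zero_iff.1 (by simp [hz])
  rw [circleProj, dif_neg h0]
  exact Circle.ext (by simp [Circle.coe_ofNormEqOne, hz])

theorem circleProj_coe (z : Circle) : circleProj z = z :=
  circleProj_of_norm_eq_one z.norm_coe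

theorem continuousOn_circleProj : ContinuousOn circleProj {0}ᶜ := by
  have hind : IsInducing (fun z : Circle => (z : ℂ)) := ⟨rfl⟩
  refine hind.continuousOn_iff.2 ?_
  have : ContinuousOn (fun z : ℂ => z / ‖z‖) {0}ᶜ :=
    continuousOn_id.div (by fun_prop) fun z hz => by simpa using hz
  refine this.congr fun z hz => ?_
  simp only [Function.comp_apply, circleProj, dif_neg (show ¬ z = 0 from hz),
    Circle.coe_ofNormEqOne]

/-- If maps from the unit sphere of `ℝ × ℂ` are nullhomotopic, a map on the torus with
nullhomotopic meridian extends to the solid torus. -/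
theorem exists_extension_solid_torus {X : Type*} [TopologicalSpace X]
    (hX : ∀ h : C(sphere (0 : ℝ × ℂ) 1, X), h.Nullhomotopic) (g : C(Circle × Circle, X))
    (hg : (g.comp (.prodMk (.const _ 1) (.id _))).Nullhomotopic) :
    ∃ F : C(Circle × closedBall (0 : ℂ) 1, X), ∀ s t : Circle,
      F (s, ⟨(t : ℂ), sphere_subset_closedBall t.2⟩) = g (s, t) := by
  let ι : C(sphere (0 : ℂ) 1, Circle) :=
    ⟨fun z => ⟨z, z.2⟩, Continuous.subtype_mk continuous_subtype_val _⟩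
  obtain ⟨k, hk⟩ := (hg.comp_left ι).exists_extension_closedBall
  have hk' : ∀ t : Circle, k ⟨t, sphere_subset_closedBall t.2⟩ = g (1, t) :=
    fun t => hk ⟨t, t.2⟩
  have hball : ∀ w : ℝ × ℂ, w ∈ sphere (0 : ℝ × ℂ) 1 → w.2 ∈ closedBall (0 : ℂ) 1 := fun w hw => by
    rw [mem_closedBall_zero_iff, ← mem_sphere_zero_iff_norm.1 hw]
    exact norm_snd_le w
  let A : sphere (0 : ℝ × ℂ) 1 → X := fun w => k ⟨w.1.2, hball w w.2⟩
  let B : sphere (0 : ℝ × ℂ) 1 → X := fun w =>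
    g (Circle.exp (Real.pi * (w.1.1 + 1)), circleProj w.1.2)
  have hmax : ∀ w : sphere (0 : ℝ × ℂ) 1, max |w.1.1| ‖w.1.2‖ = 1 := fun w =>
    mem_sphere_zero_iff_norm.1 w.2
  have hexp : ∀ r : ℝ, |r| = 1 → Circle.exp (Real.pi * (r + 1)) = 1 := fun r hr => by
    obtain rfl | rfl := eq_or_eq_neg_of_abs_eq hr
    · rw [show Real.pi * (1 + 1) = 2 * Real.pi by ring, Circle.exp_two_pi]
    · simp
  have hcont : Continuous fun w : sphere (0 : ℝ × ℂ) 1 =>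
      if |w.1.1| ≤ ‖w.1.2‖ then B w else A w := by
    refine continuous_if_le (by fun_prop) (by fun_prop) ?_ ?_ ?_
    · refine g.continuous.comp_continuousOn (ContinuousOn.prodMk (by fun_prop) ?_)
      refine continuousOn_circleProj.comp (by fun_prop) fun w hw => ?_
      have h1 := hmax w
      rw [max_eq_right hw] at h1
      simp [← norm_ne_zero_iff, h1]
    · exact Continuous.continuousOn (by fun_prop)
    · intro w hw
      have h1 := hmax w
      rw [hw, max_self] at h1
      simp only [A, B]
      rw [hexp _ (hw.trans h1), circleProj_of_norm_eq_one h1]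
      exact (hk' (.ofNormEqOne w.1.2 h1)).symm
  obtain ⟨Φ, hΦ⟩ := (hX ⟨_, hcont⟩).exists_extension_closedBall
  have hside : ∀ (r : ℝ) (t : Circle) (hr : |r| ≤ 1) (h : (r, (t : ℂ)) ∈ closedBall (0 : ℝ × ℂ) 1),
      Φ ⟨(r, t), h⟩ = g (Circle.exp (Real.pi * (r + 1)), t) := fun r t hr h => by
    have ht := t.norm_coe
    refine (hΦ ⟨(r, t), mem_sphere_zero_iff_norm.2 (?_ : max ‖r‖ ‖(t : ℂ)‖ = 1)⟩).trans ?_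
    · rw [ht]
      exact max_eq_right hr
    · refine (if_pos (hr.trans ht.ge)).trans ?_
      simp only [circleProj_coe]
  have hend : ∀ (r : ℝ) (z : closedBall (0 : ℂ) 1) (hr : |r| = 1)
      (h : (r, (z : ℂ)) ∈ closedBall (0 : ℝ × ℂ) 1), Φ ⟨(r, z), h⟩ = k z := fun r z hr h => by
    have hz : ‖(z : ℂ)‖ ≤ 1 := mem_closedBall_zero_iff.1 z.2
    rcases hz.eq_or_lt with hz | hz
    · have h1 := hside r (.ofNormEqOne z hz) hr.le h
      rw [hexp r hr] at h1
      exact h1.trans (hk' (.ofNormEqOne z hz)).symm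
    · have := hΦ ⟨(r, z), by simp [Prod.norm_def, hr, hz.le]⟩
      simpa [hr, A, hz.not_ge] using this
  have hcyl : ∀ (u : I) (z : closedBall (0 : ℂ) 1),
      ((2 * u - 1 : ℝ), (z : ℂ)) ∈ closedBall (0 : ℝ × ℂ) 1 := fun u z => by
    have hz : ‖(z : ℂ)‖ ≤ 1 := mem_closedBall_zero_iff.1 z.2
    have hu : |(2 * u - 1 : ℝ)| ≤ 1 := abs_le.2 ⟨by linarith [u.2.1], by linarith [u.2.2]⟩
    simpa [Prod.norm_def, hz] using hu
  obtain ⟨F, hF⟩ := exists_continuousMap_circle_prod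
    (⟨fun w => Φ ⟨((2 * w.1 - 1 : ℝ), (w.2 : ℂ)), hcyl w.1 w.2⟩, by fun_prop⟩ :
      C(I × closedBall (0 : ℂ) 1, X)) (fun z => by
        simp only [ContinuousMap.coe_mk]
        rw [hend _ z (by norm_num), hend _ z (by norm_num)])
  refine ⟨F, fun s t => ?_⟩
  obtain ⟨u, rfl⟩ : ∃ u : I, s = Circle.exp (2 * Real.pi * u) :=
    s.exists_unitInterval_eq_exp
  rw [hF]
  simp only [ContinuousMap.coe_mk]
  rw [hside _ t (abs_le.2 ⟨by linarith [u.2.1], by linarith [u.2.2]⟩)]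
  congr 3
  ring

/-- The straight loop in direction of a lattice vector, for a map which is periodic with respect to
the lattice. -/
noncomputable def periodicLoop {V L X : Type*} [AddCommGroup V] [Module ℝ V] [TopologicalSpace V]
    [ContinuousAdd V] [ContinuousSMul ℝ V] [AddCommGroup L] [TopologicalSpace X] (j : L →+ V)
    (G : C(V, X)) (hG : ∀ v l, G (v + j l) = G v) (l : L) : Path (G 0) (G 0) where
  toFun u := G ((u : ℝ) • j l)
  source' := by simp
  target' := by simpa using hG 0 l

theorem periodicLoop_add {V L X : Type*} [AddCommGroup V] [Module ℝ V] [TopologicalSpace V]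
    [ContinuousAdd V] [ContinuousSMul ℝ V] [AddCommGroup L] [TopologicalSpace X] (j : L →+ V)
    (G : C(V, X)) (hG : ∀ v l, G (v + j l) = G v) (l m : L) :
    (periodicLoop j G hG (l + m)).Homotopic
      ((periodicLoop j G hG l).trans (periodicLoop j G hG m)) := by
  let a : Path (0 : V) (j l) := ⟨⟨fun u => (u : ℝ) • j l, by fun_prop⟩, by simp, by simp⟩
  let b : Path (j l) (j (l + m)) :=
    ⟨⟨fun u => j l + (u : ℝ) • j m, by fun_prop⟩, by simp, by simp⟩
  let c : Path (0 : V) (j (l + m)) :=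
    ⟨⟨fun u => (u : ℝ) • j (l + m), by fun_prop⟩, by simp, by simp⟩
  have hl : ∀ l, G (j l) = G 0 := fun l => by simpa using hG 0 l
  have h := ((SimplyConnectedSpace.paths_homotopic c (a.trans b)).map G).pathCast
    rfl (hl (l + m)).symm
  have h1 : (c.map G.continuous).cast rfl (hl (l + m)).symm = periodicLoop j G hG (l + m) := rfl
  have h2 : ((a.trans b).map G.continuous).cast rfl (hl (l + m)).symm =
      (periodicLoop j G hG l).trans (periodicLoop j G hG m) := by
    ext u
    simp only [Path.map_trans, Path.cast_coe, Path.trans_apply]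
    split_ifs
    · rfl
    · change G (j l + _) = G _
      rw [add_comm, hG]
  rwa [h1, h2] at h

/-- The homomorphism from a lattice of periods to the fundamental group. -/
noncomputable def periodicLoopHom {V L X : Type*} [AddCommGroup V] [Module ℝ V]
    [TopologicalSpace V] [ContinuousAdd V] [ContinuousSMul ℝ V] [AddCommGroup L]
    [TopologicalSpace X] (j : L →+ V) (G : C(V, X)) (hG : ∀ v l, G (v + j l) = G v) :
    Multiplicative L →* FundamentalGroup X (G 0) :=
  MonoidHom.mk' (fun l => FundamentalGroup.fromPath
    (Path.Homotopic.Quotient.mk (periodicLoop j G hG l.toAdd))) fun l m => by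
      rw [mul_comm, FundamentalGroup.mul_def]
      exact Path.Homotopic.Quotient.eq.2 (periodicLoop_add j G hG m.toAdd l.toAdd)

/-- There is no injective homomorphism from `ℤ × ℤ` to `ℤ`. -/
theorem exists_ne_zero_map_eq_zero (ψ : ℤ × ℤ →+ ℤ) : ∃ v ≠ 0, ψ v = 0 := by
  have hψ : ∀ m n : ℤ, ψ (m, n) = m * ψ (1, 0) + n * ψ (0, 1) := fun m n => by
    have : ((m, n) : ℤ × ℤ) = m • (1, 0) + n • (0, 1) := by simp
    rw [this, map_add, map_zsmul, map_zsmul, smul_eq_mul, smul_eq_mul]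
  by_cases h : ψ (1, 0) = 0
  · exact ⟨(1, 0), by simp, h⟩
  · exact ⟨(ψ (0, 1), -ψ (1, 0)), by simp [h], by rw [hψ]; ring⟩

/-- A homomorphism from `ℤ × ℤ` to a group in which all nontrivial abelian subgroups are infinite
cyclic has nontrivial kernel. -/
theorem exists_ne_zero_map_eq_one {Γ : Type*} [Group Γ]
    (hΓ : ∀ H : Subgroup Γ, H ≠ ⊥ → (∀ g h : H, g * h = h * g) → Nonempty (H ≃* Multiplicative ℤ))
    (φ : Multiplicative (ℤ × ℤ) →* Γ) : ∃ v : ℤ × ℤ, v ≠ 0 ∧ φ (.ofAdd v) = 1 := by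
  by_cases hbot : φ.range = ⊥
  · exact ⟨(1, 0), by simp, by simp [MonoidHom.range_eq_bot_iff.1 hbot]⟩
  · obtain ⟨e⟩ := hΓ φ.range hbot (by
      rintro ⟨_, a, rfl⟩ ⟨_, b, rfl⟩
      exact Subtype.ext (by simp [← map_mul, mul_comm a b]))
    obtain ⟨v, hv, h⟩ := exists_ne_zero_map_eq_zero
      (MonoidHom.toAdditive (e.toMonoidHom.comp φ.rangeRestrict))
    refine ⟨v, hv, ?_⟩
    have h' : e (φ.rangeRestrict (.ofAdd v)) = 1 := h
    rw [map_eq_one_iff _ e.injective] at h'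
    exact congrArg Subtype.val h'


/-- Atoroidality via homotopy theory: if every map `S² → X` is nullhomotopic and
every nontrivial abelian subgroup of every fundamental group of `X` is infinite
cyclic, then every continuous map from the torus `S¹ × S¹` to `X` extends over
the solid torus after precomposition with a map `p (s, t) = (sᵃtᵇ, sᶜtᵈ)` with
`a*d - b*c ≠ 0`. Here `S¹` is the unit circle in `ℂ` and `D²` the closed unit
disc in `ℂ`. -/
theorem torus_map_extends_after_finite_cover
    (X : Type*) [TopologicalSpace X]
    (hS2 : ∀ g : C(Metric.sphere (0 : EuclideanSpace ℝ (Fin 3)) 1, X), g.Nullhomotopic)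
    (hab : ∀ (x : X) (H : Subgroup (FundamentalGroup X x)), H ≠ ⊥ →
      (∀ g h : H, g * h = h * g) → Nonempty (H ≃* Multiplicative ℤ))
    (f : C(Circle × Circle, X)) :
    ∃ a b c d : ℤ, a * d - b * c ≠ 0 ∧
      ∃ F : C(Circle × Metric.closedBall (0 : ℂ) 1, X),
        ∀ s t : Circle,
          F (s, ⟨(t : ℂ), Metric.sphere_subset_closedBall t.2⟩) =
            f (s ^ a * t ^ b, s ^ c * t ^ d) := by
  let j : ℤ × ℤ →+ ℝ × ℝ := (Int.castAddHom ℝ).prodMap (Int.castAddHom ℝ)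
  let G : C(ℝ × ℝ, X) := ⟨fun v =>
    f (Circle.exp (2 * Real.pi * v.1), Circle.exp (2 * Real.pi * v.2)), by fun_prop⟩
  have hG : ∀ v l, G (v + j l) = G v := fun v l => by
    simp [G, j, mul_add, Circle.exp_add, Circle.exp_two_pi_mul_int]
  obtain ⟨⟨b, d⟩, hne, hbd⟩ := exists_ne_zero_map_eq_one (hab (G 0)) (periodicLoopHom j G hG)
  have hloop : (periodicLoop j G hG (b, d)).Homotopic (Path.refl _) :=
    Path.Homotopic.Quotient.eq.1 hbd
  have hpos : d * d - b * -b ≠ 0 := fun h => hne (by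
    have hb : b = 0 := by nlinarith
    have hd : d = 0 := by nlinarith
    rw [hb, hd]; rfl)
  let g : C(Circle × Circle, X) :=
    ⟨fun w => f (w.1 ^ d * w.2 ^ b, w.1 ^ (-b) * w.2 ^ d), by fun_prop⟩
  let e : EuclideanSpace ℝ (Fin 3) ≃L[ℝ] ℝ × ℂ :=
    ContinuousLinearEquiv.ofFinrankEq (by simp [Module.finrank_prod])
  refine ⟨d, b, -b, d, hpos,
    exists_extension_solid_torus (nullhomotopic_sphere_of_equiv e hS2) g ?_⟩
  refine nullhomotopic_of_loop_homotopic_refl _ _ (fun u => ?_) hloop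
  change f (Circle.exp (2 * Real.pi * (u * b)), Circle.exp (2 * Real.pi * (u * d))) =
    f (1 ^ d * Circle.exp (2 * Real.pi * u) ^ b, 1 ^ (-b) * Circle.exp (2 * Real.pi * u) ^ d)
  simp only [one_zpow, one_mul, ← Circle.exp_intCast_mul]
  congr 3 <;> ring
end
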